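/- (Contraction property of the composed solution map, proved in the proof of Theorem B.1.) Let the model data satisfy the Lipschitz assumptions and let F : M → M be the composition F(μ) = F⃗(F⃖(μ)), where F⃖ : M → V maps μ to the unique regular solution of (E1),(E3) given μ and F⃗ : V → M maps v to the unique solution of (E2),(E4),(E5) given v. Then for all μ, μ̄ ∈ M, sup_{(t,u)∈TS} ‖F(μ)(t,u) − F(μ̄)(t,u)‖ ≤ L_Q̂ · T · ( Σ_{i=0}^{n} ( exp((Qmax + L_Q̂)·T) )^{i+1} · Jmax^i ) · (L_Ψ + K1·T) · exp(K2·T) · ( Σ_{i=0}^{n} ( exp(K2·T) · λmax · T )^i ) · sup_{(t,u)∈TS} ‖μ(t,u) − μ̄(t,u)‖. -/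

import Mathlib

open MeasureTheory
open scoped BigOperators Classical

namespace MFGShocks

/-- The probability simplex `𝒫(𝕊)` in `ℝ^S`. -/
def simplex (S : ℕ) : Set (Fin S → ℝ) :=
  {m | (∀ i, 0 ≤ m i) ∧ ∑ i, m i = 1}

/-- Membership in the parameter set `𝕌`: for some `k ≤ n`, the first `k` coordinates are
increasing and lie in `[0,T]` and the remaining coordinates equal `-1`. -/
def memU (n : ℕ) (T : ℝ) (u : Fin n → ℝ) : Prop :=
  ∃ k ≤ n, (∀ i : Fin n, (i : ℕ) < k → u i ∈ Set.Icc (0 : ℝ) T) ∧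
    (∀ i j : Fin n, (j : ℕ) < k → i ≤ j → u i ≤ u j) ∧
    (∀ i : Fin n, k ≤ (i : ℕ) → u i = -1)

/-- `Z(u)`: the number of coordinates of `u` different from `-1`, i.e.\ the number of
shocks recorded in `u`. -/
noncomputable def Zu {n : ℕ} (u : Fin n → ℝ) : ℕ :=
  (Finset.univ.filter fun i => u i ≠ -1).card

/-- Membership `(t,u) ∈ TS`. -/
def memTS (n : ℕ) (T : ℝ) (t : ℝ) (u : Fin n → ℝ) : Prop :=
  memU n T u ∧ t ∈ Set.Icc (0 : ℝ) T ∧ ∀ i, u i ≤ t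

/-- `→(u,t)`: record a new shock at time `t` (replace coordinate `Z(u)+1` of `u` by `t`). -/
noncomputable def push {n : ℕ} (u : Fin n → ℝ) (t : ℝ) : Fin n → ℝ :=
  fun i => if (i : ℕ) = Zu u then t else u i

/-- `←u`: delete the last shock (replace coordinate `Z(u)` of `u` by `-1`). -/
noncomputable def pop {n : ℕ} (u : Fin n → ℝ) : Fin n → ℝ :=
  fun i => if (i : ℕ) + 1 = Zu u then -1 else u i

/-- `t_u = u^{Z(u)}`: the time of the last shock recorded in `u` (`0` if there is none). -/
noncomputable def lastTime {n : ℕ} (u : Fin n → ℝ) : ℝ :=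
  if h : Zu u - 1 < n then u ⟨Zu u - 1, h⟩ else 0

/-- The left endpoint of the time interval associated with the parameter `u`:
`t_u` if `u` records at least one shock, and `0` otherwise. -/
noncomputable def startTime {n : ℕ} (u : Fin n → ℝ) : ℝ :=
  if Zu u = 0 then 0 else lastTime u

/-- `f` is absolutely continuous on the interval `[a,b]`. -/
def AbsContOn {E : Type*} [NormedAddCommGroup E] (f : ℝ → E) (a b : ℝ) : Prop :=
  ∀ ε > (0 : ℝ), ∃ δ > (0 : ℝ), ∀ (N : ℕ) (c d : Fin N → ℝ),
    (∀ k, a ≤ c k ∧ c k ≤ d k ∧ d k ≤ b) →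
    (∀ k l, k ≠ l → Set.Ioo (c k) (d k) ∩ Set.Ioo (c l) (d l) = ∅) →
    ∑ k, (d k - c k) < δ → ∑ k, ‖f (d k) - f (c k)‖ < ε

/-- A function `f : TS → ℝ^S` is regular if `f(·,u)` is absolutely continuous on
`[max_k u^k, T]` (intersected with `[0,T]`) for every `u ∈ 𝕌`. -/
def Regular (S n : ℕ) (T : ℝ) (f : ℝ → (Fin n → ℝ) → Fin S → ℝ) : Prop :=
  ∀ u : Fin n → ℝ, memU n T u → AbsContOn (fun t => f t u) (startTime u) T

/-- The model data: reduced-form running reward `ψ̂`, reduced-form intensity matrix `Q̂`,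
shock intensities `λ`, terminal reward `Ψ`, relocation map `J` (independent of the
distribution) and initial distribution `m₀`. -/
structure Model (S n : ℕ) where
  psi : ℝ → (Fin n → ℝ) → (Fin S → ℝ) → (Fin S → ℝ) → Fin S → ℝ
  Q : ℝ → (Fin n → ℝ) → (Fin S → ℝ) → (Fin S → ℝ) → Fin S → Fin S → ℝ
  lam : ℕ → ℝ → (Fin S → ℝ) → ℝ
  Psi : ℕ → (Fin S → ℝ) → Fin S → ℝ
  J : ℝ → Fin S → Fin S
  m0 : Fin S → ℝ

/-- The standing (boundedness, measurability, intensity-matrix and Lipschitz) assumptions on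
the model data, together with the constants `Ψmax, ψmax, Qmax, λmax, Jmax` bounding the data
and the Lipschitz constants `L_ψ̂, L_Q̂, L_Ψ, L_λ`.  Throughout, `ℝ^S` carries the maximum
norm and the matrix norm is the compatible induced one (maximal absolute row sum). -/
structure Hyps (S n : ℕ) (T : ℝ) (D : Model S n)
    (Lpsi LQ LPsi Llam Psimax psimax Qmax lammax : ℝ) (Jmax : ℕ) : Prop where
  hS : 1 ≤ S
  hn : 1 ≤ n
  hT : 0 < T
  hm0 : D.m0 ∈ simplex S
  hLpsi : 0 < Lpsi
  hLQ : 0 < LQ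
  hLPsi : 0 < LPsi
  hLlam : 0 < Llam
  psi_meas : Measurable fun p : ℝ × (Fin n → ℝ) × (Fin S → ℝ) × (Fin S → ℝ) =>
    D.psi p.1 p.2.1 p.2.2.1 p.2.2.2
  Q_meas : Measurable fun p : ℝ × (Fin n → ℝ) × (Fin S → ℝ) × (Fin S → ℝ) =>
    D.Q p.1 p.2.1 p.2.2.1 p.2.2.2
  lam_meas : ∀ k, Measurable fun p : ℝ × (Fin S → ℝ) => D.lam k p.1 p.2
  Psi_meas : ∀ k, Measurable (D.Psi k)
  J_meas : Measurable D.J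
  psi_bdd : ∀ t u m v, memTS n T t u → m ∈ simplex S → ∀ i, |D.psi t u m v i| ≤ psimax
  Q_bdd : ∀ t u m v, memTS n T t u → m ∈ simplex S → ∀ i, ∑ j, |D.Q t u m v i j| ≤ Qmax
  Q_offdiag : ∀ t u m v i j, i ≠ j → 0 ≤ D.Q t u m v i j
  Q_rowsum : ∀ t u m v i, ∑ j, D.Q t u m v i j = 0
  lam_pos : ∀ k, 1 ≤ k → k ≤ n → ∀ t ∈ Set.Icc (0 : ℝ) T, ∀ m ∈ simplex S,
    0 < D.lam k t m
  lam_bdd : ∀ k, 1 ≤ k → k ≤ n → ∀ t ∈ Set.Icc (0 : ℝ) T, ∀ m ∈ simplex S,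
    D.lam k t m ≤ lammax
  Psi_bdd : ∀ k ≤ n, ∀ m ∈ simplex S, ∀ i, |D.Psi k m i| ≤ Psimax
  psi_lip : ∀ t u, memTS n T t u → ∀ m₁ ∈ simplex S, ∀ m₂ ∈ simplex S,
    ∀ v₁ v₂ : Fin S → ℝ, ∀ i,
      |D.psi t u m₁ v₁ i - D.psi t u m₂ v₂ i| ≤ Lpsi * (‖m₁ - m₂‖ + ‖v₁ - v₂‖)
  Q_lip : ∀ t u, memTS n T t u → ∀ m₁ ∈ simplex S, ∀ m₂ ∈ simplex S,
    ∀ v₁ v₂ : Fin S → ℝ, ∀ i,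
      ∑ j, |D.Q t u m₁ v₁ i j - D.Q t u m₂ v₂ i j| ≤ LQ * (‖m₁ - m₂‖ + ‖v₁ - v₂‖)
  Psi_lip : ∀ k ≤ n, ∀ m₁ ∈ simplex S, ∀ m₂ ∈ simplex S,
    ‖D.Psi k m₁ - D.Psi k m₂‖ ≤ LPsi * ‖m₁ - m₂‖
  lam_lip : ∀ k, 1 ≤ k → k ≤ n → ∀ t ∈ Set.Icc (0 : ℝ) T, ∀ m₁ ∈ simplex S, ∀ m₂ ∈ simplex S,
    |D.lam k t m₁ - D.lam k t m₂| ≤ Llam * ‖m₁ - m₂‖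
  J_bdd : ∀ t ∈ Set.Icc (0 : ℝ) T, ∀ j : Fin S,
    (Finset.univ.filter fun i => D.J t i = j).card ≤ Jmax

/-- The constant `v_max`. -/
noncomputable def vmaxC (n : ℕ) (T Psimax psimax Qmax lammax : ℝ) : ℝ :=
  (Psimax + psimax * T) * Real.exp ((Qmax + lammax) * T) *
    ∑ i ∈ Finset.range (n + 1), (Real.exp ((Qmax + lammax) * T) * lammax * T) ^ i

/-- The constant `K₁ = L_ψ̂ + L_Q̂ v_max + 2 v_max L_λ`. -/
noncomputable def K1C (n : ℕ) (T Lpsi LQ Llam Psimax psimax Qmax lammax : ℝ) : ℝ :=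
  Lpsi + LQ * vmaxC n T Psimax psimax Qmax lammax +
    2 * vmaxC n T Psimax psimax Qmax lammax * Llam

/-- The constant `K₂ = L_ψ̂ + v_max L_Q̂ + Qmax + λmax`. -/
noncomputable def K2C (n : ℕ) (T Lpsi LQ Psimax psimax Qmax lammax : ℝ) : ℝ :=
  Lpsi + vmaxC n T Psimax psimax Qmax lammax * LQ + Qmax + lammax

/-- The right-hand side of the backward equation (E1), written for the integral
(Carathéodory) formulation `v(t,u) = Ψ(Z(u),μ(T,u)) + ∫_t^T (E1rhs)(s) ds`. -/
noncomputable def E1rhs {S n : ℕ} (D : Model S n)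
    (μ v : ℝ → (Fin n → ℝ) → Fin S → ℝ) (u : Fin n → ℝ) (i : Fin S) (s : ℝ) : ℝ :=
  D.psi s u (μ s u) (v s u) i + (∑ j, D.Q s u (μ s u) (v s u) i j * v s u j) +
    (if Zu u < n then
      D.lam (Zu u + 1) s (μ s u) * (v s (push u s) (D.J s i) - v s u i)
    else 0)

/-- `v` is a (Carathéodory) solution of the backward equation (E1) with terminal
condition (E3), given the flow `μ`. -/
def SolBackward (S n : ℕ) (T : ℝ) (D : Model S n)
    (μ v : ℝ → (Fin n → ℝ) → Fin S → ℝ) : Prop :=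
  ∀ u : Fin n → ℝ, memU n T u →
    (∀ i : Fin S, v T u i = D.Psi (Zu u) (μ T u) i) ∧
    ∀ t : ℝ, memTS n T t u → ∀ i : Fin S,
      IntervalIntegrable (E1rhs D μ v u i) volume t T ∧
      v t u i = D.Psi (Zu u) (μ T u) i + ∫ s in t..T, E1rhs D μ v u i s

/-- The right-hand side of the forward equation (E2). -/
noncomputable def E2rhs {S n : ℕ} (D : Model S n)
    (v μ : ℝ → (Fin n → ℝ) → Fin S → ℝ) (u : Fin n → ℝ) (i : Fin S) (s : ℝ) : ℝ :=
  ∑ j, μ s u j * D.Q s u (μ s u) (v s u) j i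

/-- `μ` is a (Carathéodory) solution of the forward equation (E2) with initial
condition (E4) and consistency conditions (E5), given the value function `v`. -/
def SolForward (S n : ℕ) (T : ℝ) (D : Model S n)
    (v μ : ℝ → (Fin n → ℝ) → Fin S → ℝ) : Prop :=
  (∀ i, μ 0 (fun _ => (-1 : ℝ)) i = D.m0 i) ∧
  (∀ u : Fin n → ℝ, memU n T u → 1 ≤ Zu u → ∀ j : Fin S,
    μ (lastTime u) u j =
      ∑ i, if D.J (lastTime u) i = j then μ (lastTime u) (pop u) i else 0) ∧
  (∀ u : Fin n → ℝ, memU n T u → ∀ t : ℝ, memTS n T t u → ∀ i : Fin S,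
    IntervalIntegrable (E2rhs D v μ u i) volume (startTime u) t ∧
    μ t u i = μ (startTime u) u i + ∫ s in (startTime u)..t, E2rhs D v μ u i s)

/-- Membership in `M`: a `𝒫(𝕊)`-valued function on `TS` that is `Qmax`-Lipschitz in time. -/
def MemM (S n : ℕ) (T Qmax : ℝ) (μ : ℝ → (Fin n → ℝ) → Fin S → ℝ) : Prop :=
  (∀ t u, memTS n T t u → μ t u ∈ simplex S) ∧
  ∀ u : Fin n → ℝ, memU n T u → ∀ t₁ t₂ : ℝ, memTS n T t₁ u → memTS n T t₂ u →
    ‖μ t₁ u - μ t₂ u‖ ≤ Qmax * |t₁ - t₂|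

/-- Membership in `V`: a regular function on `TS` bounded by `v_max` in supremum norm. -/
def MemV (S n : ℕ) (T vmaxVal : ℝ) (v : ℝ → (Fin n → ℝ) → Fin S → ℝ) : Prop :=
  Regular S n T v ∧ ∀ t u, memTS n T t u → ‖v t u‖ ≤ vmaxVal

/-- The supremum norm over `TS` of a function `f : TS → ℝ^S`. -/
noncomputable def supTS (S n : ℕ) (T : ℝ) (f : ℝ → (Fin n → ℝ) → Fin S → ℝ) : ℝ :=
  sSup {r : ℝ | ∃ t u, memTS n T t u ∧ r = ‖f t u‖}

end MFGShocks

namespace MFGShocks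

lemma Zu_eq_of_prefix {n k : ℕ} {T : ℝ} {u : Fin n → ℝ} (hk : k ≤ n)
    (h1 : ∀ i : Fin n, (i : ℕ) < k → u i ∈ Set.Icc (0 : ℝ) T)
    (h2 : ∀ i : Fin n, k ≤ (i : ℕ) → u i = -1) : Zu u = k := by
  have : (Finset.univ.filter fun i => u i ≠ -1) =
      Finset.univ.filter fun i : Fin n => (i : ℕ) < k := by
    ext i
    simp only [Finset.mem_filter, Finset.mem_univ, true_and]
    constructor
    · intro h
      by_contra hc
      exact h (h2 i (not_lt.1 hc))
    · intro h hc
      have := (h1 i h).1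
      linarith
  unfold Zu
  rw [this, Fin.card_filter_val_lt]
  omega

lemma memU.spec {n : ℕ} {T : ℝ} {u : Fin n → ℝ} (h : memU n T u) :
    Zu u ≤ n ∧ (∀ i : Fin n, (i : ℕ) < Zu u → u i ∈ Set.Icc (0 : ℝ) T) ∧
    (∀ i j : Fin n, (j : ℕ) < Zu u → i ≤ j → u i ≤ u j) ∧
    (∀ i : Fin n, Zu u ≤ (i : ℕ) → u i = -1) := by
  obtain ⟨k, hk, h1, h2, h3⟩ := h
  rw [Zu_eq_of_prefix hk h1 h3]
  exact ⟨hk, h1, h2, h3⟩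

lemma memU.eq_neg_one {n : ℕ} {T : ℝ} {u : Fin n → ℝ} (h : memU n T u) (h0 : Zu u = 0) :
    u = fun _ => -1 :=
  funext fun i => h.spec.2.2.2 i (by omega)

lemma lastTime_eq {n : ℕ} {T : ℝ} {u : Fin n → ℝ} (h : memU n T u) (h0 : 1 ≤ Zu u) :
    ∃ i : Fin n, (i : ℕ) + 1 = Zu u ∧ lastTime u = u i := by
  have := h.spec.1
  have h1 : Zu u - 1 < n := by omega
  exact ⟨⟨Zu u - 1, h1⟩, by simp; omega, by simp [lastTime, h1]⟩

lemma startTime_mem {n : ℕ} {T : ℝ} (hT : 0 ≤ T) {u : Fin n → ℝ} (h : memU n T u) :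
    startTime u ∈ Set.Icc 0 T := by
  unfold startTime
  split_ifs with h0
  · exact ⟨le_rfl, hT⟩
  · obtain ⟨i, hi, he⟩ := lastTime_eq h (by omega)
    rw [he]
    exact h.spec.2.1 i (by omega)

lemma memTS_iff {n : ℕ} {T : ℝ} (hT : 0 ≤ T) {u : Fin n → ℝ} (h : memU n T u) (t : ℝ) :
    memTS n T t u ↔ t ∈ Set.Icc (startTime u) T := by
  have hs := startTime_mem hT h
  obtain ⟨hk, h1, h2, h3⟩ := h.spec
  constructor
  · rintro ⟨-, ht, hu⟩
    refine ⟨?_, ht.2⟩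
    unfold startTime
    split_ifs with h0
    · exact ht.1
    · obtain ⟨i, hi, he⟩ := lastTime_eq h (by omega)
      rw [he]
      exact hu i
  · rintro ht
    have h0t : 0 ≤ t := hs.1.trans ht.1
    refine ⟨h, ⟨h0t, ht.2⟩, fun i => ?_⟩
    by_cases hi : (i : ℕ) < Zu u
    · refine le_trans ?_ ht.1
      obtain ⟨j, hj, he⟩ := lastTime_eq h (by omega)
      rw [startTime, if_neg (by omega), he]
      exact h2 i j (by omega) (Fin.le_def.2 (by omega))
    · rw [h3 i (by omega)]
      linarith

lemma memTS_push {n : ℕ} {T s : ℝ} {u : Fin n → ℝ} (h : memTS n T s u) (hu : Zu u < n) :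
    memTS n T s (push u s) ∧ Zu (push u s) = Zu u + 1 := by
  obtain ⟨hU, hs, hle⟩ := h
  obtain ⟨hk, h1, h2, h3⟩ := hU.spec
  have e1 : ∀ i : Fin n, (i : ℕ) < Zu u + 1 → push u s i ∈ Set.Icc (0 : ℝ) T := by
    intro i hi
    unfold push
    split_ifs with hc
    · exact hs
    · exact h1 i (by omega)
  have e3 : ∀ i : Fin n, Zu u + 1 ≤ (i : ℕ) → push u s i = -1 := by
    intro i hi
    rw [push, if_neg (by omega)]
    exact h3 i (by omega)
  refine ⟨⟨⟨Zu u + 1, hu, e1, ?_, e3⟩, hs, ?_⟩, Zu_eq_of_prefix hu e1 e3⟩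
  · intro i j hj hij
    rw [Fin.le_def] at hij
    unfold push
    by_cases hjc : (j : ℕ) = Zu u
    · rw [if_pos hjc]
      split_ifs
      · exact le_rfl
      · exact hle i
    · rw [if_neg hjc, if_neg (by omega)]
      exact h2 i j (by omega) hij
  · intro i
    unfold push
    split_ifs
    · exact le_rfl
    · exact hle i

lemma memTS_pop {n : ℕ} {T : ℝ} {u : Fin n → ℝ} (h : memU n T u) (hu : 1 ≤ Zu u) :
    memTS n T (lastTime u) (pop u) ∧ Zu (pop u) + 1 = Zu u := by
  obtain ⟨hk, h1, h2, h3⟩ := h.spec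
  have e1 : ∀ i : Fin n, (i : ℕ) < Zu u - 1 → pop u i ∈ Set.Icc (0 : ℝ) T := by
    intro i hi
    rw [pop, if_neg (by omega)]
    exact h1 i (by omega)
  have e3 : ∀ i : Fin n, Zu u - 1 ≤ (i : ℕ) → pop u i = -1 := by
    intro i hi
    unfold pop
    split_ifs with hc
    · rfl
    · exact h3 i (by omega)
  obtain ⟨l, hl, he⟩ := lastTime_eq h hu
  have hlT : lastTime u ∈ Set.Icc 0 T := he ▸ h1 l (by omega)
  refine ⟨⟨⟨Zu u - 1, by omega, e1, ?_, e3⟩, hlT, ?_⟩, ?_⟩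
  · intro i j hj hij
    rw [Fin.le_def] at hij
    rw [pop, pop, if_neg (by omega), if_neg (by omega)]
    exact h2 i j (by omega) hij
  · intro i
    by_cases hi : (i : ℕ) < Zu u - 1
    · rw [pop, if_neg (by omega), he]
      exact h2 i l (by omega) (Fin.le_def.2 (by omega))
    · rw [e3 i (by omega)]
      linarith [hlT.1]
  · rw [Zu_eq_of_prefix (by omega) e1 e3]
    omega

lemma AbsContOn.continuousOn {E : Type*} [NormedAddCommGroup E] {f : ℝ → E} {a b : ℝ}
    (h : AbsContOn f a b) : ContinuousOn f (Set.Icc a b) := by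
  rw [Metric.continuousOn_iff]
  intro x hx ε hε
  obtain ⟨δ, hδ, H⟩ := h ε hε
  have key : ∀ c d : ℝ, a ≤ c → c ≤ d → d ≤ b → d - c < δ → ‖f d - f c‖ < ε := by
    intro c d hac hcd hdb hlt
    have := H 1 (fun _ => c) (fun _ => d) (fun _ => ⟨hac, hcd, hdb⟩)
      (fun k l hkl => (hkl (Subsingleton.elim k l)).elim) (by simpa using hlt)
    simpa using this
  refine ⟨δ, hδ, fun y hy hyx => ?_⟩
  rw [Real.dist_eq, abs_lt] at hyx
  rcases le_total x y with hxy | hxy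
  · rw [dist_eq_norm]
    exact key x y hx.1 hxy hy.2 (by linarith)
  · rw [dist_comm, dist_eq_norm]
    exact key y x hy.1 hxy hx.2 (by linarith)

/-- Grönwall's inequality in integral form. -/
lemma le_mul_exp_of_le_add_integral {f : ℝ → ℝ} {a b C K : ℝ}
    (hf : ContinuousOn f (Set.Icc a b)) (hf0 : ∀ t ∈ Set.Icc a b, 0 ≤ f t)
    (hC : 0 ≤ C) (hK : 0 ≤ K)
    (h : ∀ t ∈ Set.Icc a b, f t ≤ C + K * ∫ s in a..t, f s) :
    ∀ t ∈ Set.Icc a b, f t ≤ C * Real.exp (K * (t - a)) := by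
  intro t ht
  have hab : a ≤ b := ht.1.trans ht.2
  set F : ℝ → ℝ := Set.IccExtend hab ((Set.Icc a b).domRestrict f) with hF
  have hFc : Continuous F := hf.domRestrict.Icc_extend'
  have hFf : ∀ x ∈ Set.Icc a b, F x = f x := fun x hx => by
    rw [hF, Set.IccExtend_of_mem hab _ hx]; rfl
  have hF0 : ∀ x, 0 ≤ F x := fun x => hf0 _ (Set.projIcc a b hab x).2
  have hint : ∀ x ∈ Set.Icc a b, ∫ s in a..x, f s = ∫ s in a..x, F s := by
    intro x hx
    refine intervalIntegral.integral_congr fun s hs => ?_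
    rw [Set.uIcc_of_le hx.1] at hs
    exact (hFf s ⟨hs.1, hs.2.trans hx.2⟩).symm
  let G : ℝ → ℝ := fun x => C + K * ∫ s in a..x, F s
  have hG : ∀ x, HasDerivAt G (K * F x) x := fun x =>
    ((hFc.integral_hasStrictDerivAt a x).hasDerivAt.const_mul K).const_add C
  have hle : ∀ x ∈ Set.Icc a b, F x ≤ G x := fun x hx => by
    rw [hFf x hx]
    have := h x hx
    rwa [hint x hx] at this
  have := norm_le_gronwallBound_of_norm_deriv_right_le (f := G) (f' := fun x => K * F x)
    (δ := C) (K := K) (ε := 0) (a := a) (b := b)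
    (fun x _ => (hG x).continuousAt.continuousWithinAt)
    (fun x _ => (hG x).hasDerivWithinAt) (by simp [G, abs_of_nonneg hC])
    (fun x hx => by
      have h1 := hle x ⟨hx.1, hx.2.le⟩
      rw [Real.norm_eq_abs, Real.norm_eq_abs, add_zero, abs_of_nonneg (mul_nonneg hK (hF0 x)),
        abs_of_nonneg ((hF0 x).trans h1)]
      gcongr) t ht
  rw [gronwallBound_ε0] at this
  calc f t = F t := (hFf t ht).symm
    _ ≤ G t := hle t ht
    _ ≤ _ := (le_abs_self _).trans this

lemma le_mul_exp_of_le_add_integral_forward {f : ℝ → ℝ} {a b A c K T : ℝ}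
    (hf : ContinuousOn f (Set.Icc a b)) (hf0 : ∀ t ∈ Set.Icc a b, 0 ≤ f t)
    (hA : 0 ≤ A) (hc : 0 ≤ c) (hK : 0 ≤ K) (hT : b - a ≤ T)
    (h : ∀ t ∈ Set.Icc a b, f t ≤ A + ∫ s in a..t, (c + K * f s)) :
    ∀ t ∈ Set.Icc a b, f t ≤ (A + c * T) * Real.exp (K * T) := by
  intro t ht
  have hab : a ≤ b := ht.1.trans ht.2
  have hT0 : 0 ≤ T := by linarith
  have := le_mul_exp_of_le_add_integral (C := A + c * T) hf hf0 (by positivity) hK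
    (fun x hx => by
      refine (h x hx).trans ?_
      have hi : IntervalIntegrable f volume a x :=
        (hf.mono (by
          rw [Set.uIcc_of_le hx.1]
          exact Set.Icc_subset_Icc_right hx.2)).intervalIntegrable
      rw [intervalIntegral.integral_add (by simp) (hi.const_mul K),
        intervalIntegral.integral_const_mul, intervalIntegral.integral_const, smul_eq_mul]
      have : (x - a) * c ≤ c * T := by
        rw [mul_comm]; gcongr; linarith [hx.2]
      linarith) t ht
  refine this.trans ?_
  gcongr
  linarith [ht.2]

lemma le_mul_exp_of_le_add_integral_backward {f : ℝ → ℝ} {a b A c K T : ℝ}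
    (hf : ContinuousOn f (Set.Icc a b)) (hf0 : ∀ t ∈ Set.Icc a b, 0 ≤ f t)
    (hA : 0 ≤ A) (hc : 0 ≤ c) (hK : 0 ≤ K) (hT : b - a ≤ T)
    (h : ∀ t ∈ Set.Icc a b, f t ≤ A + ∫ s in t..b, (c + K * f s)) :
    ∀ t ∈ Set.Icc a b, f t ≤ (A + c * T) * Real.exp (K * T) := by
  intro t ht
  have hmaps : ∀ s ∈ Set.Icc 0 (b - a), b - s ∈ Set.Icc a b := fun s hs =>
    ⟨by linarith [hs.2], by linarith [hs.1]⟩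
  have := le_mul_exp_of_le_add_integral_forward (f := fun s => f (b - s)) (a := 0) (b := b - a)
    (A := A) (c := c) (K := K) (T := T)
    (hf.comp (by fun_prop) hmaps) (fun s hs => hf0 _ (hmaps s hs)) hA hc hK (by simpa using hT)
    (fun s hs => by
      refine (h _ (hmaps s hs)).trans (le_of_eq ?_)
      rw [intervalIntegral.integral_comp_sub_left (fun s => c + K * f s) b]
      simp) (b - t) ⟨by linarith [ht.2], by linarith [ht.1]⟩
  simpa using this

lemma absolutelyContinuousOnInterval_negPart {f : ℝ → ℝ} {a b : ℝ}
    (hf : AbsolutelyContinuousOnInterval f a b) :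
    AbsolutelyContinuousOnInterval (fun t => max (-f t) 0) a b := by
  refine squeeze_zero (fun _ => Finset.sum_nonneg fun _ _ => dist_nonneg)
    (fun _ => Finset.sum_le_sum fun _ _ => ?_) hf
  rw [Real.dist_eq, Real.dist_eq]
  refine (abs_max_sub_max_le_abs _ _ _).trans (le_of_eq ?_)
  rw [abs_sub_comm]
  congr 1
  ring

lemma absolutelyContinuousOnInterval_finset_sum {ι : Type*} (s : Finset ι) {f : ι → ℝ → ℝ}
    {a b : ℝ} (hf : ∀ i ∈ s, AbsolutelyContinuousOnInterval (f i) a b) :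
    AbsolutelyContinuousOnInterval (fun t => ∑ i ∈ s, f i t) a b := by
  have h := Finset.sum_induction f (fun g => AbsolutelyContinuousOnInterval g a b)
    (fun _ _ => AbsolutelyContinuousOnInterval.add)
    (LipschitzOnWith.absolutelyContinuousOnInterval (K := 0)
      (LipschitzWith.const (0 : ℝ)).lipschitzOnWith) hf
  convert h using 1
  ext t
  simp

/-- The flow out of the negative part of `x` through a conservative intensity matrix. -/
lemma sum_neg_flow_nonneg {ι : Type*} [Fintype ι] (x : ι → ℝ) (q : ι → ι → ℝ)
    (hoff : ∀ i j, i ≠ j → 0 ≤ q i j) (hrow : ∀ i, ∑ j, q i j = 0) :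
    0 ≤ ∑ i with x i < 0, ∑ j, x j * q j i := by
  rw [Finset.sum_comm]
  refine Finset.sum_nonneg fun j _ => ?_
  rw [← Finset.mul_sum]
  by_cases hj : x j < 0
  · refine mul_nonneg_of_nonpos_of_nonpos hj.le ?_
    have hs := Finset.sum_filter_add_sum_filter_not Finset.univ (fun i => x i < 0) (q j)
    rw [hrow] at hs
    have : 0 ≤ ∑ i with ¬ x i < 0, q j i := Finset.sum_nonneg fun i hi => by
      refine hoff j i ?_
      rintro rfl
      exact (Finset.mem_filter.1 hi).2 hj
    linarith
  · refine mul_nonneg (not_lt.1 hj) (Finset.sum_nonneg fun i hi => hoff j i ?_)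
    rintro rfl
    exact hj (Finset.mem_filter.1 hi).2

/-- The simplex is invariant under the Kolmogorov forward equation. -/
lemma mem_simplex_of_forward {S : ℕ} {a b : ℝ} {x : ℝ → Fin S → ℝ}
    {q : ℝ → Fin S → Fin S → ℝ} (hab : a ≤ b) (ha : x a ∈ simplex S)
    (hoff : ∀ s i j, i ≠ j → 0 ≤ q s i j) (hrow : ∀ s i, ∑ j, q s i j = 0)
    (hint : ∀ i, IntervalIntegrable (fun s => ∑ j, x s j * q s j i) volume a b)
    (hx : ∀ t ∈ Set.Icc a b, ∀ i, x t i = x a i + ∫ s in a..t, ∑ j, x s j * q s j i) :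
    ∀ t ∈ Set.Icc a b, x t ∈ simplex S := by
  have hmono : ∀ t ∈ Set.Icc a b, Set.uIcc a t ⊆ Set.uIcc a b := fun t ht => by
    rw [Set.uIcc_of_le ht.1, Set.uIcc_of_le hab]
    exact Set.Icc_subset_Icc_right ht.2
  have hac : ∀ i, AbsolutelyContinuousOnInterval
      (fun t => x a i + ∫ s in a..t, ∑ j, x s j * q s j i) a b := fun i =>
    AbsolutelyContinuousOnInterval.add
      (LipschitzOnWith.absolutelyContinuousOnInterval (K := 0)
        (LipschitzWith.const (x a i)).lipschitzOnWith)
      ((hint i).absolutelyContinuousOnInterval_intervalIntegral Set.left_mem_uIcc)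
  set y : Fin S → ℝ → ℝ := fun i t => x a i + ∫ s in a..t, ∑ j, x s j * q s j i with hy
  set h : ℝ → ℝ := fun t => ∑ i, max (-y i t) 0 with hh
  have hhac : AbsolutelyContinuousOnInterval h a b :=
    absolutelyContinuousOnInterval_finset_sum _ fun i _ =>
      absolutelyContinuousOnInterval_negPart (hac i)
  have hha : h a = 0 := by
    simp only [hh, hy, intervalIntegral.integral_same, add_zero]
    exact Finset.sum_eq_zero fun i _ => max_eq_right (by linarith [ha.1 i])
  have hder : ∀ᵐ t, t ∈ Set.uIcc a b → deriv h t ≤ 0 := by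
    have h1 := ae_all_iff.2 fun i => (hint i).ae_hasDerivAt_integral
    filter_upwards [h1, hhac.ae_differentiableAt] with t ht1 ht2 htm
    have hyd : ∀ i, HasDerivAt (y i) (∑ j, x t j * q t j i) t := fun i =>
      (ht1 i htm a Set.left_mem_uIcc).const_add _
    have hd := (ht2 htm).hasDerivAt.add
      (HasDerivAt.fun_sum (u := Finset.univ.filter fun i => y i t < 0) fun i _ => hyd i)
    have hmin : IsLocalMin (h + fun s => ∑ i with y i t < 0, y i s) t := by
      refine Filter.Eventually.of_forall fun s => ?_
      have e0 : (h + fun s => ∑ i with y i t < 0, y i s) t = 0 := by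
        simp only [Pi.add_apply, hh]
        rw [Finset.sum_filter, ← Finset.sum_add_distrib]
        refine Finset.sum_eq_zero fun i _ => ?_
        split_ifs with hc
        · rw [max_eq_left (by linarith)]; ring
        · rw [max_eq_right (by linarith)]; ring
      rw [e0]
      simp only [Pi.add_apply, hh]
      rw [Finset.sum_filter, ← Finset.sum_add_distrib]
      refine Finset.sum_nonneg fun i _ => ?_
      split_ifs with hc
      · linarith [le_max_left (-y i s) 0]
      · linarith [le_max_right (-y i s) 0]
    have hz := hmin.hasDerivAt_eq_zero hd
    have hyx : ∀ i, y i t = x t i := fun i =>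
      (hx t (by rwa [Set.uIcc_of_le hab] at htm) i).symm
    simp only [hyx] at hz
    linarith [sum_neg_flow_nonneg (x t) (q t) (hoff t) (hrow t)]
  intro t ht
  have hle : h t ≤ 0 := by
    have := (hhac.mono (hmono t ht)).integral_deriv_eq_sub
    rw [hha, sub_zero] at this
    rw [← this, intervalIntegral.integral_of_le ht.1]
    refine integral_nonpos_of_ae ?_
    rw [Filter.EventuallyLE, ae_restrict_iff' measurableSet_Ioc]
    filter_upwards [hder] with s hs hsm
    refine hs ?_
    rw [Set.uIcc_of_le hab]
    exact ⟨hsm.1.le, hsm.2.trans ht.2⟩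
  constructor
  · intro i
    have h1 : max (-y i t) 0 ≤ h t :=
      Finset.single_le_sum (f := fun i => max (-y i t) 0) (fun i _ => le_max_right _ _)
        (Finset.mem_univ i)
    rw [hx t ht i]
    have := le_max_left (-y i t) 0
    simp only [hy] at *
    linarith
  · rw [Finset.sum_congr rfl fun i _ => hx t ht i, Finset.sum_add_distrib, ha.2,
      ← intervalIntegral.integral_finsetSum fun i _ => (hint i).mono_set (hmono t ht)]
    have : ∀ s, ∑ i, ∑ j, x s j * q s j i = 0 := fun s => by
      rw [Finset.sum_comm]
      simp [← Finset.mul_sum, hrow]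
    simp [this]

lemma abs_sum_mul_le {S : ℕ} (q w : Fin S → ℝ) : |∑ j, q j * w j| ≤ (∑ j, |q j|) * ‖w‖ := by
  refine (Finset.abs_sum_le_sum_abs _ _).trans ?_
  rw [Finset.sum_mul]
  refine Finset.sum_le_sum fun j _ => ?_
  rw [abs_mul]
  exact mul_le_mul_of_nonneg_left (norm_le_pi_norm w j) (abs_nonneg _)

lemma abs_apply_le_norm {S : ℕ} (w : Fin S → ℝ) (i : Fin S) : |w i| ≤ ‖w‖ := norm_le_pi_norm w i

/-- Backward recursion over the number of recorded shocks. -/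
lemma le_of_backward_step {n : ℕ} {T E A L : ℝ} {N : ℝ → (Fin n → ℝ) → ℝ}
    (hE : 0 ≤ E) (hA : 0 ≤ A) (hL : 0 ≤ L)
    (step : ∀ u, memU n T u → ∀ B, 0 ≤ B →
      (Zu u < n → ∀ s, memTS n T s u → N s (push u s) ≤ B) →
      ∀ t, memTS n T t u → N t u ≤ E * (A + L * B)) {t : ℝ} {u : Fin n → ℝ}
    (h : memTS n T t u) : N t u ≤ A * E * ∑ i ∈ Finset.range (n + 1), (E * L) ^ i := by
  have key : ∀ k : ℕ, ∀ t u, memTS n T t u → Zu u + k = n →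
      N t u ≤ A * E * ∑ i ∈ Finset.range (k + 1), (E * L) ^ i := by
    intro k
    induction k with
    | zero =>
      intro t u h hk
      refine (step u h.1 0 le_rfl (fun hlt => by omega) t h).trans (le_of_eq ?_)
      simp
      ring
    | succ k ih =>
      intro t u h hk
      refine (step u h.1 (A * E * ∑ i ∈ Finset.range (k + 1), (E * L) ^ i) (by positivity)
        (fun hlt s hs => ?_) t h).trans (le_of_eq ?_)
      · obtain ⟨h1, h2⟩ := memTS_push hs hlt
        exact ih s _ h1 (by omega)
      · rw [Finset.sum_range_succ' _ (k + 1)]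
        simp only [pow_succ, ← Finset.sum_mul]
        ring
  have hZ := h.1.spec.1
  refine (key (n - Zu u) t u h (by omega)).trans ?_
  refine mul_le_mul_of_nonneg_left ?_ (by positivity)
  exact Finset.sum_le_sum_of_subset_of_nonneg
    (Finset.range_mono (by omega)) fun i _ _ => by positivity

/-- Forward recursion over the number of recorded shocks. -/
lemma le_of_forward_step {n : ℕ} {T E A : ℝ} {N : ℝ → (Fin n → ℝ) → ℝ}
    (hE : 0 ≤ E) (hA : 0 ≤ A)
    (step : ∀ u, memU n T u → ∀ B, 0 ≤ B → (Zu u = 0 → N 0 u ≤ B) →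
      (1 ≤ Zu u → N (lastTime u) (pop u) ≤ B) →
      ∀ t, memTS n T t u → N t u ≤ (B + A) * E)
    (h0 : N 0 (fun _ => -1) ≤ 0) {t : ℝ} {u : Fin n → ℝ} (h : memTS n T t u) :
    N t u ≤ A * ∑ i ∈ Finset.range (n + 1), E ^ (i + 1) := by
  have key : ∀ k : ℕ, ∀ t u, memTS n T t u → Zu u = k →
      N t u ≤ A * ∑ i ∈ Finset.range (k + 1), E ^ (i + 1) := by
    intro k
    induction k with
    | zero =>
      intro t u h hk
      refine (step u h.1 0 le_rfl (fun _ => ?_) (fun hlt => by omega) t h).trans (le_of_eq ?_)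
      · rwa [h.1.eq_neg_one hk]
      · simp
    | succ k ih =>
      intro t u h hk
      obtain ⟨h1, h2⟩ := memTS_pop h.1 (by omega)
      refine (step u h.1 _ (by positivity) (fun _ => by omega)
        (fun _ => ih _ _ h1 (by omega)) t h).trans (le_of_eq ?_)
      rw [Finset.sum_range_succ' _ (k + 1)]
      simp only [pow_succ _ (_ + 1), ← Finset.sum_mul]
      ring
  refine (key (Zu u) t u h rfl).trans (mul_le_mul_of_nonneg_left ?_ hA)
  have hZ := h.1.spec.1
  exact Finset.sum_le_sum_of_subset_of_nonneg
    (Finset.range_mono (by omega)) fun i _ _ => by positivity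

lemma norm_le_sum_abs {S : ℕ} (w : Fin S → ℝ) : ‖w‖ ≤ ∑ i, |w i| :=
  (pi_norm_le_iff_of_nonneg (Finset.sum_nonneg fun _ _ => abs_nonneg _)).2 fun i =>
    Finset.single_le_sum (f := fun i => |w i|) (fun _ _ => abs_nonneg _) (Finset.mem_univ i)

lemma memTS_zero_neg_one {n : ℕ} {T : ℝ} (hT : 0 ≤ T) : memTS n T 0 (fun _ => -1) :=
  ⟨⟨0, Nat.zero_le _, fun i hi => (Nat.not_lt_zero _ hi).elim,
    fun i j hj => (Nat.not_lt_zero _ hj).elim, fun _ _ => rfl⟩, ⟨le_rfl, hT⟩,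
    fun _ => by norm_num⟩

lemma norm_le_one_of_mem_simplex_sub {S : ℕ} {m m' : Fin S → ℝ} (hm : m ∈ simplex S)
    (hm' : m' ∈ simplex S) : ‖m - m'‖ ≤ 1 := by
  refine (pi_norm_le_iff_of_nonneg zero_le_one).2 fun i => ?_
  have h1 := Finset.single_le_sum (f := m) (fun i _ => hm.1 i) (Finset.mem_univ i)
  have h2 := Finset.single_le_sum (f := m') (fun i _ => hm'.1 i) (Finset.mem_univ i)
  rw [hm.2] at h1
  rw [hm'.2] at h2
  rw [Real.norm_eq_abs, abs_le, Pi.sub_apply]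
  constructor <;> linarith [hm.1 i, hm'.1 i]

section

variable {S n : ℕ} {T : ℝ} {D : Model S n}
  {Lpsi LQ LPsi Llam Psimax psimax Qmax lammax : ℝ} {Jmax : ℕ}

lemma Hyps.bounds_nonneg (H : Hyps S n T D Lpsi LQ LPsi Llam Psimax psimax Qmax lammax Jmax) :
    0 ≤ Psimax ∧ 0 ≤ psimax ∧ 0 ≤ Qmax ∧ 0 ≤ lammax ∧ 1 ≤ Jmax := by
  have hz := memTS_zero_neg_one (n := n) H.hT.le
  let i : Fin S := ⟨0, H.hS⟩
  refine ⟨(abs_nonneg _).trans (H.Psi_bdd 0 (Nat.zero_le _) D.m0 H.hm0 i),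
    (abs_nonneg _).trans (H.psi_bdd _ _ D.m0 0 hz H.hm0 i),
    (Finset.sum_nonneg fun j _ => abs_nonneg _).trans (H.Q_bdd _ _ D.m0 0 hz H.hm0 i),
    (H.lam_pos 1 le_rfl H.hn 0 hz.2.1 D.m0 H.hm0).le.trans
      (H.lam_bdd 1 le_rfl H.hn 0 hz.2.1 D.m0 H.hm0), ?_⟩
  refine le_trans ?_ (H.J_bdd 0 hz.2.1 (D.J 0 i))
  exact Finset.card_pos.2 ⟨i, by simp⟩

lemma Hyps.vmaxC_nonneg
    (H : Hyps S n T D Lpsi LQ LPsi Llam Psimax psimax Qmax lammax Jmax) :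
    0 ≤ vmaxC n T Psimax psimax Qmax lammax := by
  obtain ⟨h1, h2, h3, h4, -⟩ := H.bounds_nonneg
  have := H.hT
  unfold vmaxC
  positivity

lemma Hyps.abs_Q_mul_le
    (H : Hyps S n T D Lpsi LQ LPsi Llam Psimax psimax Qmax lammax Jmax) {s : ℝ}
    {u : Fin n → ℝ} (hs : memTS n T s u) {m : Fin S → ℝ} (hm : m ∈ simplex S)
    (v w : Fin S → ℝ) (i : Fin S) : |∑ j, D.Q s u m v i j * w j| ≤ Qmax * ‖w‖ :=
  (abs_sum_mul_le _ _).trans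
    (mul_le_mul_of_nonneg_right (H.Q_bdd s u m v hs hm i) (norm_nonneg _))

lemma Hyps.abs_E1rhs_le
    (H : Hyps S n T D Lpsi LQ LPsi Llam Psimax psimax Qmax lammax Jmax)
    {μ v : ℝ → (Fin n → ℝ) → Fin S → ℝ} {u : Fin n → ℝ} {s B : ℝ} (hs : memTS n T s u)
    (hμ : μ s u ∈ simplex S) (hB0 : 0 ≤ B) (hB : Zu u < n → ‖v s (push u s)‖ ≤ B) (i : Fin S) :
    |E1rhs D μ v u i s| ≤ (psimax + lammax * B) + (Qmax + lammax) * ‖v s u‖ := by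
  obtain ⟨-, -, -, hl, -⟩ := H.bounds_nonneg
  have h1 := H.psi_bdd s u (μ s u) (v s u) hs hμ i
  have h2 := H.abs_Q_mul_le hs hμ (v s u) (v s u) i
  have h3 : |if Zu u < n then
      D.lam (Zu u + 1) s (μ s u) * (v s (push u s) (D.J s i) - v s u i) else 0| ≤
      lammax * (B + ‖v s u‖) := by
    split_ifs with hc
    · have e1 := H.lam_pos (Zu u + 1) (by omega) hc s hs.2.1 _ hμ
      have e2 := H.lam_bdd (Zu u + 1) (by omega) hc s hs.2.1 _ hμ
      rw [abs_mul, abs_of_pos e1]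
      refine mul_le_mul e2 ?_ (abs_nonneg _) hl
      refine (abs_sub _ _).trans (add_le_add ?_ (abs_apply_le_norm _ _))
      exact (abs_apply_le_norm _ _).trans (hB hc)
    · simp only [abs_zero]
      positivity
  refine (abs_add_three _ _ _).trans ?_
  linarith

lemma Hyps.abs_E1rhs_sub_le
    (H : Hyps S n T D Lpsi LQ LPsi Llam Psimax psimax Qmax lammax Jmax)
    {μ μ' v v' : ℝ → (Fin n → ℝ) → Fin S → ℝ} {u : Fin n → ℝ} {s B δ V : ℝ}
    (hs : memTS n T s u) (hμ : μ s u ∈ simplex S) (hμ' : μ' s u ∈ simplex S)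
    (hδ : ‖μ s u - μ' s u‖ ≤ δ) (hV : ∀ u, memTS n T s u → ‖v' s u‖ ≤ V) (hB0 : 0 ≤ B)
    (hB : Zu u < n → ‖v s (push u s) - v' s (push u s)‖ ≤ B) (i : Fin S) :
    |E1rhs D μ v u i s - E1rhs D μ' v' u i s| ≤
      ((Lpsi + LQ * V + 2 * V * Llam) * δ + lammax * B) +
        (Lpsi + V * LQ + Qmax + lammax) * ‖v s u - v' s u‖ := by
  obtain ⟨-, -, -, hl, -⟩ := H.bounds_nonneg
  have hLQ := H.hLQ
  have hLl := H.hLlam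
  have hδ0 : 0 ≤ δ := (norm_nonneg _).trans hδ
  have hV0 : 0 ≤ V := (norm_nonneg _).trans (hV u hs)
  set d := ‖v s u - v' s u‖ with hd
  have hd0 : 0 ≤ d := norm_nonneg _
  have h1 : |D.psi s u (μ s u) (v s u) i - D.psi s u (μ' s u) (v' s u) i| ≤ Lpsi * (δ + d) :=
    (H.psi_lip s u hs _ hμ _ hμ' (v s u) (v' s u) i).trans
      (mul_le_mul_of_nonneg_left (by linarith) H.hLpsi.le)
  have h2 : |(∑ j, D.Q s u (μ s u) (v s u) i j * v s u j) -
      ∑ j, D.Q s u (μ' s u) (v' s u) i j * v' s u j| ≤ Qmax * d + LQ * (δ + d) * V := by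
    have e : (∑ j, D.Q s u (μ s u) (v s u) i j * v s u j) -
        ∑ j, D.Q s u (μ' s u) (v' s u) i j * v' s u j =
        (∑ j, D.Q s u (μ s u) (v s u) i j * (v s u - v' s u) j) +
        ∑ j, (D.Q s u (μ s u) (v s u) i j - D.Q s u (μ' s u) (v' s u) i j) * v' s u j := by
      rw [← Finset.sum_sub_distrib, ← Finset.sum_add_distrib]
      refine Finset.sum_congr rfl fun j _ => ?_
      rw [Pi.sub_apply]
      ring
    rw [e]
    refine (abs_add_le _ _).trans (add_le_add (H.abs_Q_mul_le hs hμ _ _ i) ?_)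
    refine (abs_sum_mul_le _ _).trans ?_
    refine mul_le_mul ?_ (hV u hs) (norm_nonneg _) (by positivity)
    exact (H.Q_lip s u hs _ hμ _ hμ' (v s u) (v' s u) i).trans
      (mul_le_mul_of_nonneg_left (by linarith) hLQ.le)
  have h3 : |(if Zu u < n then
        D.lam (Zu u + 1) s (μ s u) * (v s (push u s) (D.J s i) - v s u i) else 0) -
      (if Zu u < n then
        D.lam (Zu u + 1) s (μ' s u) * (v' s (push u s) (D.J s i) - v' s u i) else 0)| ≤
      lammax * (B + d) + Llam * δ * (2 * V) := by
    split_ifs with hc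
    · have e1 := H.lam_pos (Zu u + 1) (by omega) hc s hs.2.1 _ hμ
      have e2 := H.lam_bdd (Zu u + 1) (by omega) hc s hs.2.1 _ hμ
      have e3 := (H.lam_lip (Zu u + 1) (by omega) hc s hs.2.1 _ hμ _ hμ').trans
        (mul_le_mul_of_nonneg_left hδ hLl.le)
      have e : D.lam (Zu u + 1) s (μ s u) * (v s (push u s) (D.J s i) - v s u i) -
          D.lam (Zu u + 1) s (μ' s u) * (v' s (push u s) (D.J s i) - v' s u i) =
          D.lam (Zu u + 1) s (μ s u) * ((v s (push u s) - v' s (push u s)) (D.J s i) -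
            (v s u - v' s u) i) +
          (D.lam (Zu u + 1) s (μ s u) - D.lam (Zu u + 1) s (μ' s u)) *
            (v' s (push u s) (D.J s i) - v' s u i) := by
        simp only [Pi.sub_apply]
        ring
      rw [e]
      refine (abs_add_le _ _).trans (add_le_add ?_ ?_)
      · rw [abs_mul, abs_of_pos e1]
        refine mul_le_mul e2 ?_ (abs_nonneg _) hl
        refine (abs_sub _ _).trans (add_le_add ?_ (abs_apply_le_norm _ _))
        exact (abs_apply_le_norm _ _).trans (hB hc)
      · rw [abs_mul]
        refine mul_le_mul e3 ?_ (abs_nonneg _) (by positivity)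
        refine (abs_sub _ _).trans ?_
        have e4 := (abs_apply_le_norm (v' s (push u s)) (D.J s i)).trans
          (hV _ (memTS_push hs hc).1)
        have e5 := (abs_apply_le_norm (v' s u) i).trans (hV u hs)
        linarith
    · simp only [sub_zero, abs_zero]
      positivity
  have e : E1rhs D μ v u i s - E1rhs D μ' v' u i s =
      (D.psi s u (μ s u) (v s u) i - D.psi s u (μ' s u) (v' s u) i) +
      ((∑ j, D.Q s u (μ s u) (v s u) i j * v s u j) -
        ∑ j, D.Q s u (μ' s u) (v' s u) i j * v' s u j) +
      ((if Zu u < n then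
        D.lam (Zu u + 1) s (μ s u) * (v s (push u s) (D.J s i) - v s u i) else 0) -
      (if Zu u < n then
        D.lam (Zu u + 1) s (μ' s u) * (v' s (push u s) (D.J s i) - v' s u i) else 0)) := by
    unfold E1rhs
    ring
  rw [e]
  refine (abs_add_three _ _ _).trans ?_
  linarith

lemma abs_integral_le_integral_affine {a b c K : ℝ} {f g : ℝ → ℝ} (hab : a ≤ b)
    (hf : ContinuousOn f (Set.Icc a b)) (hg : ∀ s ∈ Set.Icc a b, |g s| ≤ c + K * f s) :
    |∫ s in a..b, g s| ≤ ∫ s in a..b, (c + K * f s) := by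
  refine intervalIntegral.norm_integral_le_of_norm_le (f := g) (g := fun s => c + K * f s) hab
    (Filter.Eventually.of_forall fun s hs => hg s ⟨hs.1.le, hs.2⟩) ?_
  refine ContinuousOn.intervalIntegrable ?_
  rw [Set.uIcc_of_le hab]
  fun_prop

lemma Hyps.norm_solBackward_le
    (H : Hyps S n T D Lpsi LQ LPsi Llam Psimax psimax Qmax lammax Jmax)
    {μ v : ℝ → (Fin n → ℝ) → Fin S → ℝ} (hμ : MemM S n T Qmax μ) (hreg : Regular S n T v)
    (hv : SolBackward S n T D μ v) {t : ℝ} {u : Fin n → ℝ} (h : memTS n T t u) :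
    ‖v t u‖ ≤ vmaxC n T Psimax psimax Qmax lammax := by
  obtain ⟨h1, h2, h3, h4, -⟩ := H.bounds_nonneg
  have hT := H.hT
  refine (le_of_backward_step (N := fun t u => ‖v t u‖) (T := T)
    (E := Real.exp ((Qmax + lammax) * T)) (A := Psimax + psimax * T) (L := lammax * T)
    (by positivity) (by positivity) (by positivity) ?_ h).trans
    (le_of_eq (by rw [vmaxC, mul_assoc (Real.exp _) lammax T]))
  intro u hu B hB hBu t ht
  have hst := startTime_mem hT.le hu
  have hcont := (hreg u hu).continuousOn
  have hTS := memTS_iff hT.le hu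
  refine (le_mul_exp_of_le_add_integral_backward (A := Psimax) (c := psimax + lammax * B)
    (K := Qmax + lammax) (T := T) hcont.norm (fun _ _ => norm_nonneg _) h1
    (by positivity) (by positivity) (by linarith [hst.1]) ?_ t ((hTS t).1 ht)).trans
    (le_of_eq (by ring))
  intro r hr
  have hsub : Set.Icc r T ⊆ Set.Icc (startTime u) T := Set.Icc_subset_Icc_left hr.1
  have hint : ∀ i, |∫ s in r..T, E1rhs D μ v u i s| ≤
      ∫ s in r..T, (psimax + lammax * B + (Qmax + lammax) * ‖v s u‖) := fun i =>
    abs_integral_le_integral_affine hr.2 (hcont.norm.mono hsub) fun s hs => by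
      have hs' := (hTS s).2 (hsub hs)
      exact H.abs_E1rhs_le hs' (hμ.1 s u hs') hB (fun hc => hBu hc s hs') i
  refine (pi_norm_le_iff_of_nonneg ?_).2 fun i => ?_
  · exact add_nonneg h1 ((abs_nonneg _).trans (hint ⟨0, H.hS⟩))
  · rw [((hv u hu).2 r ((hTS r).2 hr) i).2]
    refine (abs_add_le _ _).trans (add_le_add ?_ (hint i))
    exact H.Psi_bdd _ hu.spec.1 _ (hμ.1 T u ((hTS T).2 ⟨hst.2, le_rfl⟩)) i

lemma Hyps.norm_solBackward_sub_le
    (H : Hyps S n T D Lpsi LQ LPsi Llam Psimax psimax Qmax lammax Jmax)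
    {μ μ' v v' : ℝ → (Fin n → ℝ) → Fin S → ℝ}
    (hμ : MemM S n T Qmax μ) (hμ' : MemM S n T Qmax μ')
    (hreg : Regular S n T v) (hv : SolBackward S n T D μ v)
    (hreg' : Regular S n T v') (hv' : SolBackward S n T D μ' v')
    {δ : ℝ} (hδ : ∀ t u, memTS n T t u → ‖μ t u - μ' t u‖ ≤ δ)
    {t : ℝ} {u : Fin n → ℝ} (h : memTS n T t u) :
    ‖v t u - v' t u‖ ≤
      (LPsi + K1C n T Lpsi LQ Llam Psimax psimax Qmax lammax * T) *
          Real.exp (K2C n T Lpsi LQ Psimax psimax Qmax lammax * T) *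
          (∑ i ∈ Finset.range (n + 1),
            (Real.exp (K2C n T Lpsi LQ Psimax psimax Qmax lammax * T) * lammax * T) ^ i) * δ := by
  obtain ⟨-, -, h3, h4, -⟩ := H.bounds_nonneg
  have hT := H.hT
  have hδ0 : 0 ≤ δ := (norm_nonneg _).trans (hδ t u h)
  have hV := H.vmaxC_nonneg
  have hLpsi := H.hLpsi
  have hLPsi := H.hLPsi
  have hLQ := H.hLQ
  have hLlam := H.hLlam
  have hK1 : 0 ≤ K1C n T Lpsi LQ Llam Psimax psimax Qmax lammax := by
    unfold K1C
    positivity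
  have hK2 : 0 ≤ K2C n T Lpsi LQ Psimax psimax Qmax lammax := by
    unfold K2C
    positivity
  set K1 := K1C n T Lpsi LQ Llam Psimax psimax Qmax lammax with hK1d
  set K2 := K2C n T Lpsi LQ Psimax psimax Qmax lammax with hK2d
  refine (le_of_backward_step (N := fun t u => ‖v t u - v' t u‖) (T := T)
    (E := Real.exp (K2 * T)) (A := (LPsi + K1 * T) * δ) (L := lammax * T)
    (by positivity) (by positivity) (by positivity) ?_ h).trans
    (le_of_eq (by rw [mul_assoc (Real.exp _) lammax T]; ring))
  intro u hu B hB hBu t ht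
  have hst := startTime_mem hT.le hu
  have hcont : ContinuousOn (fun t => ‖v t u - v' t u‖) (Set.Icc (startTime u) T) :=
    ((hreg u hu).continuousOn.sub (hreg' u hu).continuousOn).norm
  have hTS := memTS_iff hT.le hu
  refine (le_mul_exp_of_le_add_integral_backward (A := LPsi * δ) (c := K1 * δ + lammax * B)
    (K := K2) (T := T) hcont (fun _ _ => norm_nonneg _) (by positivity)
    (by positivity) hK2 (by linarith [hst.1]) ?_ t ((hTS t).1 ht)).trans
    (le_of_eq (by ring))
  intro r hr
  have hsub : Set.Icc r T ⊆ Set.Icc (startTime u) T := Set.Icc_subset_Icc_left hr.1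
  have hint : ∀ i, |∫ s in r..T, (E1rhs D μ v u i s - E1rhs D μ' v' u i s)| ≤
      ∫ s in r..T, (K1 * δ + lammax * B + K2 * ‖v s u - v' s u‖) := fun i =>
    abs_integral_le_integral_affine hr.2 (hcont.mono hsub) fun s hs => by
      have hs' := (hTS s).2 (hsub hs)
      exact H.abs_E1rhs_sub_le hs' (hμ.1 s u hs') (hμ'.1 s u hs') (hδ s u hs')
        (fun w hw => H.norm_solBackward_le hμ' hreg' hv' hw) hB (fun hc => hBu hc s hs') i
  refine (pi_norm_le_iff_of_nonneg ?_).2 fun i => ?_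
  · exact add_nonneg (by positivity) ((abs_nonneg _).trans (hint ⟨0, H.hS⟩))
  · have hr' := (hTS r).2 hr
    have hTT := (hTS T).2 ⟨hst.2, le_rfl⟩
    obtain ⟨i1, e1⟩ := (hv u hu).2 r hr' i
    obtain ⟨i2, e2⟩ := (hv' u hu).2 r hr' i
    have e : v r u i - v' r u i = (D.Psi (Zu u) (μ T u) i - D.Psi (Zu u) (μ' T u) i) +
        ∫ s in r..T, (E1rhs D μ v u i s - E1rhs D μ' v' u i s) := by
      rw [intervalIntegral.integral_sub i1 i2, e1, e2]
      ring
    rw [Pi.sub_apply, Real.norm_eq_abs, e]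
    refine (abs_add_le _ _).trans (add_le_add ?_ (hint i))
    refine (abs_apply_le_norm (D.Psi (Zu u) (μ T u) - D.Psi (Zu u) (μ' T u)) i).trans ?_
    exact (H.Psi_lip _ hu.spec.1 _ (hμ.1 T u hTT) _ (hμ'.1 T u hTT)).trans
      (mul_le_mul_of_nonneg_left (hδ T u hTT) hLPsi.le)

lemma Hyps.solForward_mem_simplex
    (H : Hyps S n T D Lpsi LQ LPsi Llam Psimax psimax Qmax lammax Jmax)
    {v ρ : ℝ → (Fin n → ℝ) → Fin S → ℝ} (hρ : SolForward S n T D v ρ) {t : ℝ}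
    {u : Fin n → ℝ} (h : memTS n T t u) : ρ t u ∈ simplex S := by
  have hT := H.hT.le
  have key : ∀ k : ℕ, ∀ t u, memTS n T t u → Zu u = k → ρ t u ∈ simplex S := by
    intro k
    induction k with
    | zero =>
      intro t u h hk
      have hst := startTime_mem hT h.1
      have hTS := memTS_iff hT h.1
      refine mem_simplex_of_forward (q := fun s => D.Q s u (ρ s u) (v s u)) hst.2 ?_
        (fun s => H.Q_offdiag _ _ _ _) (fun s => H.Q_rowsum _ _ _ _)
        (fun i => (hρ.2.2 u h.1 T ((hTS T).2 ⟨hst.2, le_rfl⟩) i).1)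
        (fun r hr i => (hρ.2.2 u h.1 r ((hTS r).2 hr) i).2) t ((hTS t).1 h)
      have : ρ (startTime u) u = D.m0 := by
        ext i
        rw [startTime, if_pos hk, h.1.eq_neg_one hk, hρ.1 i]
      rw [this]
      exact H.hm0
    | succ k ih =>
      intro t u h hk
      have hst := startTime_mem hT h.1
      have hTS := memTS_iff hT h.1
      refine mem_simplex_of_forward (q := fun s => D.Q s u (ρ s u) (v s u)) hst.2 ?_
        (fun s => H.Q_offdiag _ _ _ _) (fun s => H.Q_rowsum _ _ _ _)
        (fun i => (hρ.2.2 u h.1 T ((hTS T).2 ⟨hst.2, le_rfl⟩) i).1)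
        (fun r hr i => (hρ.2.2 u h.1 r ((hTS r).2 hr) i).2) t ((hTS t).1 h)
      obtain ⟨hp, hpk⟩ := memTS_pop h.1 (by omega)
      have hps := ih _ _ hp (by omega)
      rw [startTime, if_neg (by omega)]
      refine ⟨fun j => ?_, ?_⟩
      · rw [hρ.2.1 u h.1 (by omega) j]
        refine Finset.sum_nonneg fun i _ => ?_
        split_ifs
        · exact hps.1 i
        · exact le_rfl
      · rw [Finset.sum_congr rfl fun j _ => hρ.2.1 u h.1 (by omega) j, Finset.sum_comm]
        simpa using hps.2
  exact key _ t u h rfl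

lemma Hyps.sum_abs_E2rhs_sub_le
    (H : Hyps S n T D Lpsi LQ LPsi Llam Psimax psimax Qmax lammax Jmax)
    {v v' ρ ρ' : ℝ → (Fin n → ℝ) → Fin S → ℝ} {u : Fin n → ℝ} {s δ : ℝ}
    (hs : memTS n T s u) (hρ : ρ s u ∈ simplex S) (hρ' : ρ' s u ∈ simplex S)
    (hδ : ‖v s u - v' s u‖ ≤ δ) :
    ∑ i, |E2rhs D v ρ u i s - E2rhs D v' ρ' u i s| ≤
      LQ * δ + (Qmax + LQ) * ∑ i, |ρ s u i - ρ' s u i| := by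
  set Q := D.Q s u (ρ s u) (v s u)
  set Q' := D.Q s u (ρ' s u) (v' s u)
  set f := ∑ i, |ρ s u i - ρ' s u i| with hf
  have hQ : ∀ j, ∑ i, |Q j i - Q' j i| ≤ LQ * (f + δ) := fun j =>
    (H.Q_lip s u hs _ hρ _ hρ' (v s u) (v' s u) j).trans
      (mul_le_mul_of_nonneg_left
        (add_le_add (norm_le_sum_abs (ρ s u - ρ' s u)) hδ) H.hLQ.le)
  calc ∑ i, |E2rhs D v ρ u i s - E2rhs D v' ρ' u i s|
      ≤ ∑ i, ∑ j, (|ρ s u j - ρ' s u j| * |Q j i| + ρ' s u j * |Q j i - Q' j i|) := by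
        refine Finset.sum_le_sum fun i _ => ?_
        unfold E2rhs
        rw [← Finset.sum_sub_distrib]
        refine (Finset.abs_sum_le_sum_abs _ _).trans (Finset.sum_le_sum fun j _ => ?_)
        rw [show ρ s u j * Q j i - ρ' s u j * Q' j i =
          (ρ s u j - ρ' s u j) * Q j i + ρ' s u j * (Q j i - Q' j i) by ring]
        refine (abs_add_le _ _).trans ?_
        rw [abs_mul, abs_mul, abs_of_nonneg (hρ'.1 j)]
    _ = ∑ j, (|ρ s u j - ρ' s u j| * ∑ i, |Q j i| + ρ' s u j * ∑ i, |Q j i - Q' j i|) := by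
        rw [Finset.sum_comm]
        simp only [Finset.sum_add_distrib, Finset.mul_sum]
    _ ≤ ∑ j, (|ρ s u j - ρ' s u j| * Qmax + ρ' s u j * (LQ * (f + δ))) :=
        Finset.sum_le_sum fun j _ => add_le_add
          (mul_le_mul_of_nonneg_left (H.Q_bdd s u _ _ hs hρ j) (abs_nonneg _))
          (mul_le_mul_of_nonneg_left (hQ j) (hρ'.1 j))
    _ = LQ * δ + (Qmax + LQ) * f := by
        rw [Finset.sum_add_distrib, ← Finset.sum_mul, ← Finset.sum_mul, hρ'.2, ← hf]
        ring

/-- Relocation does not increase the `ℓ¹` distance. -/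
lemma sum_abs_relocate_sub_le (J : Fin S → Fin S) (m m' : Fin S → ℝ) :
    ∑ j, |(∑ i, if J i = j then m i else 0) - ∑ i, if J i = j then m' i else 0| ≤
      ∑ i, |m i - m' i| := by
  calc _ ≤ ∑ j, ∑ i, (if J i = j then |m i - m' i| else 0) := by
        refine Finset.sum_le_sum fun j _ => ?_
        rw [← Finset.sum_sub_distrib]
        refine (Finset.abs_sum_le_sum_abs _ _).trans (Finset.sum_le_sum fun i _ => ?_)
        split_ifs <;> simp
    _ = _ := by
        rw [Finset.sum_comm]
        simp

lemma Hyps.sum_abs_solForward_sub_le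
    (H : Hyps S n T D Lpsi LQ LPsi Llam Psimax psimax Qmax lammax Jmax)
    {v v' ρ ρ' : ℝ → (Fin n → ℝ) → Fin S → ℝ}
    (hreg : Regular S n T ρ) (hρ : SolForward S n T D v ρ)
    (hreg' : Regular S n T ρ') (hρ' : SolForward S n T D v' ρ')
    {δ : ℝ} (hδ : ∀ t u, memTS n T t u → ‖v t u - v' t u‖ ≤ δ)
    {t : ℝ} {u : Fin n → ℝ} (h : memTS n T t u) :
    ∑ i, |ρ t u i - ρ' t u i| ≤
      LQ * δ * T * ∑ i ∈ Finset.range (n + 1), (Real.exp ((Qmax + LQ) * T)) ^ (i + 1) := by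
  obtain ⟨-, -, h3, -, -⟩ := H.bounds_nonneg
  have hT := H.hT
  have hLQ := H.hLQ
  have hδ0 : 0 ≤ δ := (norm_nonneg _).trans (hδ t u h)
  refine le_of_forward_step (N := fun t u => ∑ i, |ρ t u i - ρ' t u i|) (T := T)
    (E := Real.exp ((Qmax + LQ) * T)) (A := LQ * δ * T) (by positivity) (by positivity) ?_
    (by simp [hρ.1, hρ'.1]) h
  intro u hu B hB hB0 hB1 t ht
  have hst := startTime_mem hT.le hu
  have hTS := memTS_iff hT.le hu
  have hcont : ContinuousOn (fun t => ∑ i, |ρ t u i - ρ' t u i|) (Set.Icc (startTime u) T) := by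
    refine continuousOn_finsetSum _ fun i _ => ContinuousOn.abs ?_
    exact (continuousOn_pi.1 (hreg u hu).continuousOn i).sub
      (continuousOn_pi.1 (hreg' u hu).continuousOn i)
  have hstart : ∑ i, |ρ (startTime u) u i - ρ' (startTime u) u i| ≤ B := by
    unfold startTime
    split_ifs with hc
    · exact hB0 hc
    · refine le_trans ?_ (hB1 (by omega))
      simp only [hρ.2.1 u hu (by omega), hρ'.2.1 u hu (by omega)]
      exact sum_abs_relocate_sub_le _ _ _
  refine le_mul_exp_of_le_add_integral_forward (A := B) (c := LQ * δ)
    (K := Qmax + LQ) (T := T) hcont (fun _ _ => Finset.sum_nonneg fun _ _ => abs_nonneg _) hB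
    (by positivity) (by positivity) (by linarith [hst.1]) ?_ t ((hTS t).1 ht)
  intro r hr
  have hi : ∀ i, IntervalIntegrable
      (fun s => E2rhs D v ρ u i s - E2rhs D v' ρ' u i s) volume (startTime u) r := fun i =>
    (hρ.2.2 u hu r ((hTS r).2 hr) i).1.sub (hρ'.2.2 u hu r ((hTS r).2 hr) i).1
  have hbound : ∀ i, |ρ r u i - ρ' r u i| ≤ |ρ (startTime u) u i - ρ' (startTime u) u i| +
      ∫ s in (startTime u)..r, |E2rhs D v ρ u i s - E2rhs D v' ρ' u i s| := by
    intro i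
    obtain ⟨i1, e1⟩ := hρ.2.2 u hu r ((hTS r).2 hr) i
    obtain ⟨i2, e2⟩ := hρ'.2.2 u hu r ((hTS r).2 hr) i
    have e : ρ r u i - ρ' r u i = (ρ (startTime u) u i - ρ' (startTime u) u i) +
        ∫ s in (startTime u)..r, (E2rhs D v ρ u i s - E2rhs D v' ρ' u i s) := by
      rw [intervalIntegral.integral_sub i1 i2, e1, e2]
      ring
    rw [e]
    exact (abs_add_le _ _).trans
      (add_le_add le_rfl (intervalIntegral.abs_integral_le_integral_abs hr.1))
  refine (Finset.sum_le_sum fun i _ => hbound i).trans ?_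
  rw [Finset.sum_add_distrib, ← intervalIntegral.integral_finsetSum fun i _ => (hi i).abs]
  refine add_le_add hstart (intervalIntegral.integral_mono_on hr.1 ?_ ?_ fun s hs => ?_)
  · simpa only [Finset.sum_fn] using IntervalIntegrable.sum Finset.univ fun i _ => (hi i).abs
  · refine ContinuousOn.intervalIntegrable ?_
    rw [Set.uIcc_of_le hr.1]
    exact continuousOn_const.add
      (continuousOn_const.mul (hcont.mono (Set.Icc_subset_Icc_right hr.2)))
  · have hs' := (hTS s).2 ⟨hs.1, hs.2.trans hr.2⟩
    exact H.sum_abs_E2rhs_sub_le hs' (H.solForward_mem_simplex hρ hs')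
      (H.solForward_mem_simplex hρ' hs') (hδ s u hs')

end

/-- **Contraction property of the composed solution map** `F = F⃗ ∘ F⃖ : M → M` (inside the
proof of Theorem B.1). If `μ, μ̄ ∈ M`, `v, v̄` are the unique regular solutions of the
backward system (E1), (E3) given `μ`, `μ̄`, and `ρ = F(μ)`, `ρ̄ = F(μ̄)` are the unique
solutions of the forward system (E2), (E4), (E5) given `v`, `v̄`, then
`sup_{TS} ‖F(μ) − F(μ̄)‖ ≤ L_Q̂ T (Σ_{i=0}^{n} (e^{(Qmax+L_Q̂)T})^{i+1} Jmax^i)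
  (L_Ψ + K₁T) e^{K₂T} (Σ_{i=0}^{n} (e^{K₂T} λmax T)^i) · sup_{TS} ‖μ − μ̄‖`. -/
theorem composed_map_contraction (S n : ℕ) (T : ℝ) (D : Model S n)
    (Lpsi LQ LPsi Llam Psimax psimax Qmax lammax : ℝ) (Jmax : ℕ)
    (H : Hyps S n T D Lpsi LQ LPsi Llam Psimax psimax Qmax lammax Jmax)
    (μ μ' : ℝ → (Fin n → ℝ) → Fin S → ℝ)
    (hμ : MemM S n T Qmax μ) (hμ' : MemM S n T Qmax μ')
    (v v' : ℝ → (Fin n → ℝ) → Fin S → ℝ)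
    (hvreg : Regular S n T v) (hv : SolBackward S n T D μ v)
    (hv'reg : Regular S n T v') (hv' : SolBackward S n T D μ' v')
    (ρ ρ' : ℝ → (Fin n → ℝ) → Fin S → ℝ)
    (hρreg : Regular S n T ρ) (hρ : SolForward S n T D v ρ)
    (hρ'reg : Regular S n T ρ') (hρ' : SolForward S n T D v' ρ') :
    supTS S n T (fun t u => ρ t u - ρ' t u) ≤
      LQ * T * (∑ i ∈ Finset.range (n + 1),
          (Real.exp ((Qmax + LQ) * T)) ^ (i + 1) * (Jmax : ℝ) ^ i) *
        ((LPsi + K1C n T Lpsi LQ Llam Psimax psimax Qmax lammax * T) *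
          Real.exp (K2C n T Lpsi LQ Psimax psimax Qmax lammax * T) *
          ∑ i ∈ Finset.range (n + 1),
            (Real.exp (K2C n T Lpsi LQ Psimax psimax Qmax lammax * T) * lammax * T) ^ i) *
        supTS S n T (fun t u => μ t u - μ' t u) := by
  have hT := H.hT
  have hLQ := H.hLQ
  obtain ⟨-, -, -, -, hJ⟩ := H.bounds_nonneg
  have hJ' : (1 : ℝ) ≤ Jmax := by exact_mod_cast hJ
  have hδ : ∀ t u, memTS n T t u → ‖μ t u - μ' t u‖ ≤ supTS S n T (fun t u => μ t u - μ' t u) :=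
    fun t u h => le_csSup
      ⟨1, by
        rintro r ⟨t, u, h, rfl⟩
        exact norm_le_one_of_mem_simplex_sub (hμ.1 t u h) (hμ'.1 t u h)⟩
      ⟨t, u, h, rfl⟩
  set δ := supTS S n T (fun t u => μ t u - μ' t u)
  have hv_sub := fun t u (h : memTS n T t u) =>
    H.norm_solBackward_sub_le hμ hμ' hvreg hv hv'reg hv' hδ h
  have hz := memTS_zero_neg_one (n := n) hT.le
  have hnn := (norm_nonneg _).trans (hv_sub _ _ hz)
  refine csSup_le ⟨_, _, _, hz, rfl⟩ ?_
  rintro r ⟨t, u, h, rfl⟩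
  refine (norm_le_sum_abs _).trans
    ((H.sum_abs_solForward_sub_le hρreg hρ hρ'reg hρ' hv_sub h).trans ?_)
  generalize (LPsi + K1C n T Lpsi LQ Llam Psimax psimax Qmax lammax * T) *
          Real.exp (K2C n T Lpsi LQ Psimax psimax Qmax lammax * T) *
          ∑ i ∈ Finset.range (n + 1),
            (Real.exp (K2C n T Lpsi LQ Psimax psimax Qmax lammax * T) * lammax * T) ^ i = C at *
  have hsum : ∑ i ∈ Finset.range (n + 1), Real.exp ((Qmax + LQ) * T) ^ (i + 1) ≤
      ∑ i ∈ Finset.range (n + 1), Real.exp ((Qmax + LQ) * T) ^ (i + 1) * (Jmax : ℝ) ^ i :=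
    Finset.sum_le_sum fun i _ => le_mul_of_one_le_right (by positivity) (one_le_pow₀ hJ')
  refine (mul_le_mul_of_nonneg_left hsum (by positivity)).trans (le_of_eq ?_)
  ring

end MFGShocks
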